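/- In a CAT(1) space, if ξ and ξ̂ are points at distance exactly π and γ⁻, γ⁺ are two geodesics from ξ to ξ̂ making angle θ < π at ξ, then γ⁻ ∪ γ⁺ bounds a spherical lune of angle θ, i.e. a convex subset isometric to the join S⁰ ∘ [0, θ]; if the angle at ξ is ≥ π then γ⁻ ∪ γ⁺ is a round circle of length 2π. -/

import Mathlib

open Real Set Filter

noncomputable section

/-- `γ` restricted to `[a,b]` is a unit-speed geodesic. -/
def IsGeodesicOn {Z : Type*} [MetricSpace Z] (γ : ℝ → Z) (a b : ℝ) : Prop :=
  ∀ s ∈ Set.Icc a b, ∀ t ∈ Set.Icc a b, dist (γ s) (γ t) = |s - t|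

/-- A geodesic from `x` to `y` parametrized by arclength on `[0, dist x y]`. -/
def GeodesicBetween {Z : Type*} [MetricSpace Z] (γ : ℝ → Z) (x y : Z) : Prop :=
  γ 0 = x ∧ γ (dist x y) = y ∧ IsGeodesicOn γ 0 (dist x y)

/-- The comparison distance in the unit sphere `S²`: in a spherical comparison triangle
with side lengths `a = |x y|`, `b = |x z|`, `c = |y z|`, the distance from the vertex
`z̄` to the point at distance `s` from `x̄` on the side `x̄ ȳ`
(spherical law of cosines). -/
noncomputable def sphCompDist (a b c s : ℝ) : ℝ :=
  Real.arccos (Real.cos b * Real.cos s +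
    Real.sin b * Real.sin s *
      ((Real.cos c - Real.cos a * Real.cos b) / (Real.sin a * Real.sin b)))

/-- A CAT(1) space: a complete metric space in which points at distance `< π` are joined
by geodesics and in which triangles of perimeter `< 2π` are no thicker than their
comparison triangles in the unit sphere `S²`. -/
class IsCATOne (Z : Type*) [MetricSpace Z] : Prop where
  complete : CompleteSpace Z
  geodesics : ∀ x y : Z, dist x y < π → ∃ γ : ℝ → Z, GeodesicBetween γ x y
  comparison : ∀ x y z : Z, dist x y + dist y z + dist z x < 2 * π →
    ∀ γ : ℝ → Z, GeodesicBetween γ x y →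
      ∀ s ∈ Set.Icc (0 : ℝ) (dist x y),
        dist z (γ s) ≤ sphCompDist (dist x y) (dist x z) (dist y z) s

/-- The (Alexandrov) angle between two unit-speed geodesics emanating from a common
point equals `θ`: the comparison angles converge to `θ`. -/
def AngleAt {Z : Type*} [MetricSpace Z] (γ₁ γ₂ : ℝ → Z) (θ : ℝ) : Prop :=
  Filter.Tendsto (fun t : ℝ => 2 * Real.arcsin (dist (γ₁ t) (γ₂ t) / (2 * t)))
    (nhdsWithin 0 (Set.Ioi 0)) (nhds θ)

/-- π-convexity: a subset containing every geodesic between its points at distance `< π`. -/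
def PiConvex {Z : Type*} [MetricSpace Z] (C : Set Z) : Prop :=
  ∀ p ∈ C, ∀ q ∈ C, dist p q < π → ∀ γ : ℝ → Z, GeodesicBetween γ p q →
    ∀ t ∈ Set.Icc (0 : ℝ) (dist p q), γ t ∈ C


open scoped RealInnerProductSpace

/-- Spherical (angular) distance between vectors of `ℝ³`. -/
noncomputable def sph3Dist (u v : EuclideanSpace ℝ (Fin 3)) : ℝ := Real.arccos ⟪u, v⟫

/-- The model spherical 2-lune of angle `θ` in the unit sphere `S² ⊂ ℝ³`:
the spherical join `S⁰ ∘ [0,θ]`. -/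
def LuneModel (θ : ℝ) : Set (EuclideanSpace ℝ (Fin 3)) :=
  {v | ∃ s ∈ Set.Icc (0 : ℝ) π, ∃ φ ∈ Set.Icc (0 : ℝ) θ,
    v 0 = Real.cos s ∧ v 1 = Real.sin s * Real.cos φ ∧ v 2 = Real.sin s * Real.sin φ}


namespace LuneAux

/-- `γ` is a unit speed geodesic of length `π` from `x` to `y`. -/
def Geo {Z : Type*} [MetricSpace Z] (γ : ℝ → Z) (x y : Z) : Prop :=
  γ 0 = x ∧ γ π = y ∧ IsGeodesicOn γ 0 π

theorem Geo.rev {Z : Type*} [MetricSpace Z] {γ : ℝ → Z} {x y : Z} (h : Geo γ x y) :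
    Geo (fun s => γ (π - s)) y x := by
  obtain ⟨h0, h1, h2⟩ := h
  refine ⟨by simpa using h1, by simpa using h0, ?_⟩
  intro s hs t ht
  have := h2 (π - s) ⟨by linarith [hs.2], by linarith [hs.1]⟩ (π - t)
    ⟨by linarith [ht.2], by linarith [ht.1]⟩
  simp only [this]
  rw [← abs_neg]; congr 1; ring

theorem Geo.dl {Z : Type*} [MetricSpace Z] {γ : ℝ → Z} {x y : Z} (h : Geo γ x y)
    {s : ℝ} (hs : s ∈ Icc 0 π) : dist x (γ s) = s := by
  obtain ⟨h0, h1, h2⟩ := h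
  rw [← h0, h2 0 ⟨le_rfl, pi_pos.le⟩ s hs]
  simp [abs_of_nonneg hs.1]

theorem Geo.dr {Z : Type*} [MetricSpace Z] {γ : ℝ → Z} {x y : Z} (h : Geo γ x y)
    {s : ℝ} (hs : s ∈ Icc 0 π) : dist (γ s) y = π - s := by
  obtain ⟨h0, h1, h2⟩ := h
  rw [← h1, h2 s hs π ⟨pi_pos.le, le_rfl⟩, abs_sub_comm, abs_of_nonneg]
  linarith [hs.2]

theorem dist_le {Z : Type*} [MetricSpace Z] {γ η : ℝ → Z} {x y : Z} (h : Geo γ x y)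
    (h' : Geo η x y) {s t : ℝ} (hs : s ∈ Icc 0 π) (ht : t ∈ Icc 0 π) :
    dist (γ s) (η t) ≤ s + t ∧ dist (γ s) (η t) ≤ 2 * π - s - t ∧
    dist (γ s) (η t) ≤ π ∧ |s - t| ≤ dist (γ s) (η t) := by
  have a1 := h.dl hs
  have a2 := h'.dl ht
  have b1 := h.dr hs
  have b2 := h'.dr ht
  have e1 := dist_triangle_left (γ s) (η t) x
  have e2 := dist_triangle_right (γ s) (η t) y
  have e3 := dist_triangle x (γ s) (η t)
  have e4 := dist_triangle_right x (γ s) (η t)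
  refine ⟨by linarith, by linarith, by linarith, ?_⟩
  rw [abs_le]; constructor <;> linarith

theorem cos_bounds {Z : Type*} [MetricSpace Z] {γ η : ℝ → Z} {x y : Z} (h : Geo γ x y)
    (h' : Geo η x y) {s t : ℝ} (hs : s ∈ Icc 0 π) (ht : t ∈ Icc 0 π) :
    cos (s + t) ≤ cos (dist (γ s) (η t)) ∧ cos (dist (γ s) (η t)) ≤ cos (s - t) := by
  obtain ⟨d1, d2, d3, d4⟩ := dist_le h h' hs ht
  have d0 : 0 ≤ dist (γ s) (η t) := dist_nonneg
  constructor
  · rcases le_total (s + t) π with hc | hc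
    · exact cos_le_cos_of_nonneg_of_le_pi d0 hc d1
    · rw [← cos_two_pi_sub (s + t)]
      exact cos_le_cos_of_nonneg_of_le_pi d0 (by linarith) (by linarith)
  · rw [← cos_abs (s - t)]
    exact cos_le_cos_of_nonneg_of_le_pi (abs_nonneg _) d3 d4

theorem step {Z : Type*} [MetricSpace Z] [IsCATOne Z] {γ η : ℝ → Z} {x y : Z} (h : Geo γ x y)
    (h' : Geo η x y) {s s' t κ : ℝ} (hs' : 0 < s') (hss : s' ≤ s) (hs : s < π)
    (ht0 : 0 < t) (ht : t < π) (hκ : -1 < κ)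
    (hP : cos (dist (γ s) (η t)) = cos s * cos t + sin s * sin t * κ) :
    cos s' * cos t + sin s' * sin t * κ ≤ cos (dist (γ s') (η t)) := by
  have hsI : s ∈ Icc 0 π := ⟨by linarith, hs.le⟩
  have htI : t ∈ Icc 0 π := ⟨ht0.le, ht.le⟩
  have hsI' : s' ∈ Icc 0 π := ⟨by linarith, by linarith⟩
  obtain ⟨d1, d2, d3, d4⟩ := dist_le h h' hsI htI
  have d0 : 0 ≤ dist (γ s) (η t) := dist_nonneg
  have ss : 0 < sin s := sin_pos_of_pos_of_lt_pi (by linarith) hs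
  have st : 0 < sin t := sin_pos_of_pos_of_lt_pi ht0 ht
  have ss' : 0 < sin s' := sin_pos_of_pos_of_lt_pi hs' (by linarith)
  have sst := mul_pos ss st
  have sst' := mul_pos ss' st
  have hκ1 : κ ≤ 1 := by
    have := (cos_bounds h h' hsI htI).2
    rw [hP, cos_sub] at this
    by_contra hc
    push Not at hc
    nlinarith
  have hgt : cos (s + t) < cos (dist (γ s) (η t)) := by
    rw [hP, cos_add]; nlinarith
  have hne1 : dist (γ s) (η t) ≠ s + t := fun e => by rw [e] at hgt; exact lt_irrefl _ hgt
  have hne2 : dist (γ s) (η t) ≠ 2 * π - s - t := fun e => by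
    rw [e, show 2 * π - s - t = 2 * π - (s + t) by ring, cos_two_pi_sub] at hgt
    exact lt_irrefl _ hgt
  have g1 := lt_of_le_of_ne d1 hne1
  have g2 := lt_of_le_of_ne d2 hne2
  have dx : dist x (γ s) = s := h.dl hsI
  have dy : dist x (η t) = t := h'.dl htI
  have hg : GeodesicBetween γ x (γ s) := by
    refine ⟨h.1, by rw [dx], ?_⟩
    rw [dx]
    intro a ha b hb
    exact h.2.2 a ⟨ha.1, ha.2.trans hs.le⟩ b ⟨hb.1, hb.2.trans hs.le⟩
  have key := IsCATOne.comparison x (γ s) (η t)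
    (by rw [dx, dist_comm (η t) x, dy]; linarith) γ hg s' (by rw [dx]; exact ⟨hs'.le, hss⟩)
  rw [dx, dy, sphCompDist, hP] at key
  have e : (cos s * cos t + sin s * sin t * κ - cos s * cos t) / (sin s * sin t) = κ := by
    field_simp; ring
  rw [e] at key
  set X := cos t * cos s' + sin t * sin s' * κ with hX
  have hX1 : X ≤ 1 := by
    have : X ≤ cos (t - s') := by rw [cos_sub, hX]; nlinarith
    exact this.trans (cos_le_one _)
  have hXm : -1 ≤ X := by
    have : cos (t + s') ≤ X := by rw [cos_add, hX]; nlinarith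
    exact (neg_one_le_cos _).trans this
  have := cos_le_cos_of_nonneg_of_le_pi dist_nonneg (arccos_le_pi X) key
  rw [cos_arccos hXm hX1, dist_comm] at this
  calc _ = X := by rw [hX]; ring
    _ ≤ _ := this

theorem step' {Z : Type*} [MetricSpace Z] [IsCATOne Z] {γ η : ℝ → Z} {x y : Z} (h : Geo γ x y)
    (h' : Geo η x y) {s s' t κ : ℝ} (hs0 : 0 < s) (hs : s < π) (hs0' : 0 < s') (hs' : s' < π)
    (ht0 : 0 < t) (ht : t < π) (hκ : -1 < κ)
    (hP : cos (dist (γ s) (η t)) = cos s * cos t + sin s * sin t * κ) :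
    cos s' * cos t + sin s' * sin t * κ ≤ cos (dist (γ s') (η t)) := by
  rcases le_total s' s with hc | hc
  · exact step h h' hs0' hc hs ht0 ht hκ hP
  · have := step h.rev h'.rev (s := π - s) (s' := π - s') (t := π - t) (κ := κ)
      (by linarith) (by linarith) (by linarith) (by linarith) (by linarith) hκ
      (by simp only [sub_sub_cancel, cos_pi_sub, sin_pi_sub]; rw [hP]; ring)
    simp only [sub_sub_cancel, cos_pi_sub, sin_pi_sub] at this
    linarith

theorem slide {Z : Type*} [MetricSpace Z] [IsCATOne Z] {γ η : ℝ → Z} {x y : Z} (h : Geo γ x y)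
    (h' : Geo η x y) {s s' t κ : ℝ} (hs0 : 0 < s) (hs : s < π) (hs0' : 0 < s') (hs' : s' < π)
    (ht0 : 0 < t) (ht : t < π) (hκ : -1 < κ)
    (hP : cos (dist (γ s) (η t)) = cos s * cos t + sin s * sin t * κ) :
    cos (dist (γ s') (η t)) = cos s' * cos t + sin s' * sin t * κ := by
  have h1 := step' h h' hs0 hs hs0' hs' ht0 ht hκ hP
  have ss : 0 < sin s := sin_pos_of_pos_of_lt_pi hs0 hs
  have st : 0 < sin t := sin_pos_of_pos_of_lt_pi ht0 ht
  have ss' : 0 < sin s' := sin_pos_of_pos_of_lt_pi hs0' hs'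
  have sst := mul_pos ss st
  have sst' := mul_pos ss' st
  obtain ⟨κ', hκ'⟩ : ∃ κ', cos (dist (γ s') (η t)) = cos s' * cos t + sin s' * sin t * κ' :=
    ⟨(cos (dist (γ s') (η t)) - cos s' * cos t) / (sin s' * sin t), by field_simp; ring⟩
  have hle : κ ≤ κ' := by
    rw [hκ'] at h1
    exact le_of_mul_le_mul_left (by linarith) sst'
  have h2 := step' h h' hs0' hs' hs0 hs ht0 ht (by linarith) hκ'
  rw [hP] at h2
  have hle' : κ' ≤ κ := le_of_mul_le_mul_left (by linarith) sst
  rw [hκ', le_antisymm hle hle']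

theorem const_aux {Z : Type*} [MetricSpace Z] [IsCATOne Z] {γ η : ℝ → Z} {x y : Z}
    (h : Geo γ x y) (h' : Geo η x y) :
    ∃ κ : ℝ, -1 ≤ κ ∧ κ ≤ 1 ∧ ∀ s ∈ Ioo 0 π, ∀ t ∈ Ioo 0 π,
      cos (dist (γ s) (η t)) = cos s * cos t + sin s * sin t * κ := by
  by_cases hex : ∃ s ∈ Ioo 0 π, ∃ t ∈ Ioo 0 π, cos (s + t) < cos (dist (γ s) (η t))
  · obtain ⟨s, hs, t, ht, hlt⟩ := hex
    have sst := mul_pos (sin_pos_of_pos_of_lt_pi hs.1 hs.2) (sin_pos_of_pos_of_lt_pi ht.1 ht.2)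
    have ub := (cos_bounds h h' (Ioo_subset_Icc_self hs) (Ioo_subset_Icc_self ht)).2
    obtain ⟨κ, hκ⟩ : ∃ κ, cos (dist (γ s) (η t)) = cos s * cos t + sin s * sin t * κ :=
      ⟨(cos (dist (γ s) (η t)) - cos s * cos t) / (sin s * sin t),
        by rw [mul_div_cancel₀ _ sst.ne']; ring⟩
    rw [hκ, cos_add] at hlt
    rw [hκ, cos_sub] at ub
    have k1 : -1 < κ := lt_of_mul_lt_mul_left (by linarith) sst.le
    have k2 : κ ≤ 1 := le_of_mul_le_mul_left (by linarith) sst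
    refine ⟨κ, k1.le, k2, ?_⟩
    intro s' hs' t' ht'
    have e1 := slide h h' hs.1 hs.2 hs'.1 hs'.2 ht.1 ht.2 k1 hκ
    have e2 := slide h' h ht.1 ht.2 ht'.1 ht'.2 hs'.1 hs'.2 k1
      (by rw [dist_comm, e1]; ring)
    rw [dist_comm, e2]; ring
  · push Not at hex
    refine ⟨-1, le_rfl, by norm_num, ?_⟩
    intro s hs t ht
    have lb := (cos_bounds h h' (Ioo_subset_Icc_self hs) (Ioo_subset_Icc_self ht)).1
    have := le_antisymm (hex s hs t ht) lb
    rw [this, cos_add]; ring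

theorem const {Z : Type*} [MetricSpace Z] [IsCATOne Z] {γ η : ℝ → Z} {x y : Z}
    (h : Geo γ x y) (h' : Geo η x y) :
    ∃ κ : ℝ, -1 ≤ κ ∧ κ ≤ 1 ∧ ∀ s ∈ Icc 0 π, ∀ t ∈ Icc 0 π,
      cos (dist (γ s) (η t)) = cos s * cos t + sin s * sin t * κ := by
  obtain ⟨κ, h1, h2, h3⟩ := const_aux h h'
  refine ⟨κ, h1, h2, ?_⟩
  intro s hs t ht
  rcases eq_or_lt_of_le hs.1 with e | l1
  · rw [← e, h.1, h'.dl ht]; simp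
  rcases eq_or_lt_of_le hs.2 with e | l2
  · rw [e, h.2.1, dist_comm, h'.dr ht]; simp
  rcases eq_or_lt_of_le ht.1 with e | l3
  · rw [← e, h'.1, dist_comm, h.dl hs]; simp
  rcases eq_or_lt_of_le ht.2 with e | l4
  · rw [e, h'.2.1, h.dr hs]; simp
  exact h3 s ⟨l1, l2⟩ t ⟨l3, l4⟩

theorem angle_eq {Z : Type*} [MetricSpace Z] {γ η : ℝ → Z} {x y : Z}
    (h : Geo γ x y) (h' : Geo η x y) {κ θ : ℝ} (k1 : -1 ≤ κ) (k2 : κ ≤ 1)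
    (hP : ∀ s ∈ Icc 0 π, ∀ t ∈ Icc 0 π,
      cos (dist (γ s) (η t)) = cos s * cos t + sin s * sin t * κ)
    (hθ : AngleAt γ η θ) : θ = arccos κ := by
  set c := sin (arccos κ / 2) with hc
  have c0 : 0 ≤ c := sin_nonneg_of_nonneg_of_le_pi (by linarith [arccos_nonneg κ])
    (by linarith [arccos_le_pi κ, pi_pos])
  have hc2 : κ = 1 - 2 * c ^ 2 := by
    have := cos_sq' (arccos κ / 2)
    have e := cos_two_mul (arccos κ / 2)
    rw [show 2 * (arccos κ / 2) = arccos κ by ring, cos_arccos k1 k2] at e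
    rw [e, this]; ring
  have hd : ∀ t ∈ Ioo 0 π, dist (γ t) (η t) / 2 = arcsin (sin t * c) := by
    intro t ht
    have hI := Ioo_subset_Icc_self ht
    have e := hP t hI t hI
    have dp := (dist_le h h' hI hI).2.2.1
    have d0 : 0 ≤ dist (γ t) (η t) := dist_nonneg
    set d := dist (γ t) (η t) with hdd
    have e2 := cos_two_mul (d / 2)
    rw [show 2 * (d / 2) = d by ring, cos_sq'] at e2
    have s0 : 0 ≤ sin (d / 2) := sin_nonneg_of_nonneg_of_le_pi (by linarith) (by linarith [pi_pos])
    have st : 0 ≤ sin t := (sin_pos_of_pos_of_lt_pi ht.1 ht.2).le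
    have sq : sin (d / 2) ^ 2 = (sin t * c) ^ 2 := by
      have := sin_sq_add_cos_sq t
      rw [hc2] at e
      nlinarith
    have := (sq_eq_sq₀ s0 (mul_nonneg st c0)).1 sq
    rw [← this, arcsin_sin (by linarith [pi_pos]) (by linarith)]
  have hder : HasDerivAt (fun t : ℝ => arcsin (sin t * c)) c 0 := by
    have a : HasDerivAt (fun t : ℝ => sin t * c) (cos 0 * c) 0 := (hasDerivAt_sin 0).mul_const c
    have b : HasDerivAt arcsin (1 / √(1 - (sin 0 * c) ^ 2)) (sin 0 * c) :=
      hasDerivAt_arcsin (by simp) (by simp)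
    have := b.comp (0 : ℝ) a
    simpa [Function.comp_def] using this
  have hsl := (hasDerivAt_iff_tendsto_slope.1 hder).mono_left
    (nhdsWithin_mono 0 (fun t (ht : t ∈ Ioi (0 : ℝ)) => (ne_of_gt ht : t ≠ 0)))
  have hlim : AngleAt γ η (2 * arcsin c) := by
    have := ((continuous_arcsin.tendsto c).comp hsl).const_mul 2
    refine this.congr' ?_
    filter_upwards [Ioo_mem_nhdsGT pi_pos] with t ht
    simp only [Function.comp_apply, slope_def_field]
    rw [← hd t ht]
    simp only [sin_zero, zero_mul, arcsin_zero, sub_zero]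
    rw [div_div]
  have := tendsto_nhds_unique hθ hlim
  rw [this, hc, arcsin_sin (by linarith [arccos_nonneg κ, pi_pos]) (by linarith [arccos_le_pi κ])]
  ring

theorem dist_eq {Z : Type*} [MetricSpace Z] {γ η : ℝ → Z} {x y : Z}
    (h : Geo γ x y) (h' : Geo η x y) {X s t : ℝ} (hs : s ∈ Icc 0 π) (ht : t ∈ Icc 0 π)
    (hX : cos (dist (γ s) (η t)) = X) : dist (γ s) (η t) = arccos X := by
  rw [← hX, arccos_cos dist_nonneg (dist_le h h' hs ht).2.2.1]

/-- Spherical coordinates. -/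
def sp (s φ : ℝ) : EuclideanSpace ℝ (Fin 3) := !₂[cos s, sin s * cos φ, sin s * sin φ]

theorem inner_sp (s φ t ψ : ℝ) :
    ⟪sp s φ, sp t ψ⟫ = cos s * cos t + sin s * sin t * cos (φ - ψ) := by
  simp [sp, PiLp.inner_apply, Fin.sum_univ_three, cos_sub]
  ring

theorem norm_sp (s φ : ℝ) : ‖sp s φ‖ = 1 := by
  have := inner_sp s φ s φ
  rw [real_inner_self_eq_norm_sq] at this
  have h2 := sin_sq_add_cos_sq s
  have : ‖sp s φ‖ ^ 2 = 1 := by rw [this]; simp; nlinarith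
  nlinarith [norm_nonneg (sp s φ)]

theorem extend_map {Z I : Type*} [MetricSpace Z] (g : I → Z) (h : I → EuclideanSpace ℝ (Fin 3))
    (hn : ∀ i, ‖h i‖ = 1) (hd : ∀ i j, dist (g i) (g j) = sph3Dist (h i) (h j)) :
    ∃ f : Z → EuclideanSpace ℝ (Fin 3), ∀ i, f (g i) = h i := by
  refine ⟨Function.extend g h 0, ?_⟩
  have hf : Function.FactorsThrough h g := by
    intro i j hij
    have := hd i j
    rw [hij, dist_self, sph3Dist, eq_comm, arccos_eq_zero] at this
    have hle := real_inner_le_norm (h i) (h j)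
    rw [hn, hn] at hle
    exact (inner_eq_one_iff_of_norm_eq_one (𝕜 := ℝ) (hn i) (hn j)).1 (by linarith)
  intro i
  exact hf.extend_apply 0 i

theorem exists_through {Z : Type*} [MetricSpace Z] [IsCATOne Z] {x y m : Z}
    (hxy : dist x y = π) (h1 : dist x m = π / 2) (h2 : dist m y = π / 2) :
    ∃ γ : ℝ → Z, Geo γ x y ∧ γ (π / 2) = m := by
  obtain ⟨α, a0, a1, ag⟩ := IsCATOne.geodesics x m (by rw [h1]; linarith [pi_pos])
  obtain ⟨β, b0, b1, bg⟩ := IsCATOne.geodesics m y (by rw [h2]; linarith [pi_pos])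
  rw [h1] at a1 ag
  rw [h2] at b1 bg
  have pp := pi_pos
  refine ⟨fun t => if t ≤ π / 2 then α t else β (t - π / 2), ⟨?_, ?_, ?_⟩, ?_⟩
  · simp only
    rw [if_pos (by linarith), a0]
  · simp only
    rw [if_neg (by linarith), ← b1]; congr 1; ring
  · have mixed : ∀ s t, 0 ≤ s → s ≤ π / 2 → π / 2 < t → t ≤ π →
        dist (α s) (β (t - π / 2)) = t - s := by
      intro s t hs hs' ht ht'
      have u1 := ag s ⟨hs, hs'⟩ (π / 2) ⟨by linarith, le_rfl⟩
      have u2 := bg 0 ⟨le_rfl, by linarith⟩ (t - π / 2) ⟨by linarith, by linarith⟩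
      have u3 := ag 0 ⟨le_rfl, by linarith⟩ s ⟨hs, hs'⟩
      have u4 := bg (t - π / 2) ⟨by linarith, by linarith⟩ (π / 2) ⟨by linarith, le_rfl⟩
      rw [abs_sub_comm, abs_of_nonneg (by linarith)] at u1 u2 u3 u4
      rw [a1] at u1
      rw [b0] at u2
      rw [a0] at u3
      rw [b1] at u4
      have t1 := dist_triangle (α s) m (β (t - π / 2))
      have t2 := dist_triangle4 x (α s) (β (t - π / 2)) y
      linarith
    intro s hs t ht
    simp only
    split_ifs with c1 c2 c2
    · exact ag s ⟨hs.1, c1⟩ t ⟨ht.1, c2⟩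
    · push Not at c2
      rw [mixed s t hs.1 c1 c2 ht.2, abs_sub_comm, abs_of_nonneg (by linarith)]
    · push Not at c1
      rw [dist_comm, mixed t s ht.1 c2 c1 hs.2, abs_of_nonneg (by linarith)]
    · push Not at c1 c2
      rw [bg (s - π / 2) ⟨by linarith, by linarith [hs.2]⟩ (t - π / 2)
        ⟨by linarith, by linarith [ht.2]⟩]
      congr 1; ring
  · simp [a1]

theorem unique_point {Z : Type*} [MetricSpace Z] [IsCATOne Z] {p q m : Z} {γ : ℝ → Z} {t : ℝ}
    (hpq : dist p q < π) (hγ : GeodesicBetween γ p q) (ht : t ∈ Icc 0 (dist p q))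
    (h1 : dist p m = t) (h2 : dist q m = dist p q - t) : γ t = m := by
  have key := IsCATOne.comparison p q m (by rw [h2, dist_comm m p, h1]; linarith) γ hγ t ht
  have e : sphCompDist (dist p q) (dist p m) (dist q m) t = 0 := by
    rw [h1, h2, sphCompDist, arccos_eq_zero]
    rcases eq_or_lt_of_le ht.1 with e | l
    · rw [← e]; simp
    have st : 0 < sin t := sin_pos_of_pos_of_lt_pi l (by linarith [ht.2])
    have sd : 0 < sin (dist p q) := sin_pos_of_pos_of_lt_pi (by linarith [ht.2]) hpq
    rw [cos_sub]
    have : (cos (dist p q) * cos t + sin (dist p q) * sin t - cos (dist p q) * cos t) /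
        (sin (dist p q) * sin t) = 1 := by field_simp; ring
    rw [this]
    nlinarith [sin_sq_add_cos_sq t]
  rw [e] at key
  exact (dist_le_zero.1 key).symm

/-- The planar sector of angle `θ < π` is closed under addition. -/
theorem sector {θ : ℝ} (hθ0 : 0 ≤ θ) (hθ : θ < π) {a b φ ψ : ℝ} (ha : 0 ≤ a) (hb : 0 ≤ b)
    (hφ : φ ∈ Icc 0 θ) (hψ : ψ ∈ Icc 0 θ) :
    ∃ r, 0 ≤ r ∧ ∃ χ ∈ Icc 0 θ, a * cos φ + b * cos ψ = r * cos χ ∧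
      a * sin φ + b * sin ψ = r * sin χ := by
  wlog hle : φ ≤ ψ generalizing a b φ ψ
  · obtain ⟨r, hr, χ, hχ, e1, e2⟩ := this hb ha hψ hφ (by linarith)
    exact ⟨r, hr, χ, hχ, by linarith, by linarith⟩
  -- rotate by `-φ`
  set z : ℂ := ⟨a + b * cos (ψ - φ), b * sin (ψ - φ)⟩ with hz
  have hsn : 0 ≤ sin (ψ - φ) := sin_nonneg_of_nonneg_of_le_pi (by linarith)
    (by linarith [hψ.2, hφ.1])
  have ec : ‖z‖ * cos z.arg = a + b * cos (ψ - φ) := Complex.norm_mul_cos_arg z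
  have es : ‖z‖ * sin z.arg = b * sin (ψ - φ) := Complex.norm_mul_sin_arg z
  have harg0 : 0 ≤ z.arg := Complex.arg_nonneg_iff.2 (mul_nonneg hb hsn)
  have hcomb : ∀ χ, ‖z‖ * cos χ = a + b * cos (ψ - φ) → ‖z‖ * sin χ = b * sin (ψ - φ) →
      a * cos φ + b * cos ψ = ‖z‖ * cos (φ + χ) ∧ a * sin φ + b * sin ψ = ‖z‖ * sin (φ + χ) := by
    intro χ e1 e2
    have hψe : ψ = φ + (ψ - φ) := by ring
    constructor
    · rw [cos_add, mul_sub, mul_left_comm, e1, mul_left_comm, e2]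
      conv_lhs => rw [hψe, cos_add]
      ring
    · rw [sin_add, mul_add, mul_left_comm, e1, mul_left_comm, e2]
      conv_lhs => rw [hψe, sin_add]
      ring
  by_cases hz0 : z = 0
  · have := hcomb 0 (by rw [← ec, hz0]; simp) (by rw [← es, hz0]; simp)
    exact ⟨‖z‖, norm_nonneg _, φ + 0, by simpa using hφ, this.1, this.2⟩
  have hzp : 0 < ‖z‖ := norm_pos_iff.2 hz0
  have hargle : z.arg ≤ ψ - φ := by
    by_contra hc
    push Not at hc
    have hpos : 0 < sin (z.arg - (ψ - φ)) := by
      rcases lt_or_eq_of_le (Complex.arg_le_pi z) with hl | he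
      · exact sin_pos_of_pos_of_lt_pi (by linarith) (by linarith)
      · by_cases hps : ψ - φ = 0
        · exfalso
          rw [hps] at ec
          rw [he] at ec
          simp at ec
          linarith
        · have : 0 < ψ - φ := lt_of_le_of_ne (by linarith) (Ne.symm hps)
          exact sin_pos_of_pos_of_lt_pi (by linarith) (by linarith)
    have : ‖z‖ * sin (z.arg - (ψ - φ)) = - (a * sin (ψ - φ)) := by
      rw [sin_sub, mul_sub, ← mul_assoc, ← mul_assoc, es, ec]; ring
    have h3 := mul_pos hzp hpos
    have h4 := mul_nonneg ha hsn
    linarith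
  have := hcomb z.arg ec es
  exact ⟨‖z‖, norm_nonneg _, φ + z.arg, ⟨by linarith [hφ.1], by linarith [hψ.2]⟩, this.1, this.2⟩

theorem polar {u r : ℝ} (hr : 0 ≤ r) (h : u ^ 2 + r ^ 2 = 1) :
    ∃ s ∈ Icc 0 π, cos s = u ∧ sin s = r := by
  refine ⟨arccos u, ⟨arccos_nonneg _, arccos_le_pi _⟩,
    cos_arccos (by nlinarith) (by nlinarith), ?_⟩
  rw [sin_arccos, show 1 - u ^ 2 = r ^ 2 by linarith, sqrt_sq hr]

/-- The model lune is geodesically convex. -/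
theorem model_convex {θ : ℝ} (hθ0 : 0 ≤ θ) (hθ : θ < π) {s φ s' φ' d t : ℝ}
    (hs : s ∈ Icc 0 π) (hφ : φ ∈ Icc 0 θ) (hs' : s' ∈ Icc 0 π) (hφ' : φ' ∈ Icc 0 θ)
    (hd : d < π) (hdpos : 0 < d) (ht : t ∈ Icc 0 d) (hin : ⟪sp s φ, sp s' φ'⟫ = cos d) :
    ∃ r ∈ Icc 0 π, ∃ χ ∈ Icc 0 θ, ⟪sp s φ, sp r χ⟫ = cos t ∧ ⟪sp s' φ', sp r χ⟫ = cos (d - t) := by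
  have sd : 0 < sin d := sin_pos_of_pos_of_lt_pi hdpos hd
  set A := sin (d - t) / sin d with hA
  set B := sin t / sin d with hB
  have A0 : 0 ≤ A := div_nonneg
    (sin_nonneg_of_nonneg_of_le_pi (by linarith [ht.2]) (by linarith [ht.1])) sd.le
  have B0 : 0 ≤ B := div_nonneg
    (sin_nonneg_of_nonneg_of_le_pi ht.1 (by linarith [ht.2])) sd.le
  have hAd : A * sin d = sin d * cos t - cos d * sin t := by
    rw [hA, div_mul_cancel₀ _ sd.ne', sin_sub]
  have hBd : B * sin d = sin t := by rw [hB, div_mul_cancel₀ _ sd.ne']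
  have I1 : A + B * cos d = cos t := by
    apply mul_right_cancel₀ sd.ne'
    linear_combination hAd + cos d * hBd
  have I2 : A * cos d + B = cos (d - t) := by
    apply mul_right_cancel₀ sd.ne'
    rw [cos_sub]
    linear_combination cos d * hAd + hBd - sin t * sin_sq_add_cos_sq d
  have I3 : A ^ 2 + B ^ 2 + 2 * A * B * cos d = 1 := by
    have : A * cos t + B * cos (d - t) = 1 := by
      apply mul_right_cancel₀ sd.ne'
      rw [cos_sub]
      linear_combination cos t * hAd + (cos d * cos t + sin d * sin t) * hBd
        + sin d * sin_sq_add_cos_sq t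
    rw [← I1, ← I2] at this
    linear_combination this
  have ss := sin_nonneg_of_nonneg_of_le_pi hs.1 hs.2
  have ss' := sin_nonneg_of_nonneg_of_le_pi hs'.1 hs'.2
  obtain ⟨ρ, hρ, χ, hχ, e1, e2⟩ := sector hθ0 hθ (mul_nonneg A0 ss) (mul_nonneg B0 ss') hφ hφ'
  rw [inner_sp] at hin
  have hsq : (A * cos s + B * cos s') ^ 2 + ρ ^ 2 = 1 := by
    have hρ2 : ρ ^ 2 = (ρ * cos χ) ^ 2 + (ρ * sin χ) ^ 2 := by
      linear_combination (-ρ ^ 2) * sin_sq_add_cos_sq χ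
    rw [hρ2, ← e1, ← e2, ← I3, ← hin, cos_sub]
    linear_combination (A ^ 2 * sin s ^ 2) * sin_sq_add_cos_sq φ +
      (B ^ 2 * sin s' ^ 2) * sin_sq_add_cos_sq φ' + A ^ 2 * sin_sq_add_cos_sq s +
      B ^ 2 * sin_sq_add_cos_sq s'
  obtain ⟨r, hr, c1, c2⟩ := polar hρ hsq
  rw [cos_sub] at hin
  refine ⟨r, hr, χ, hχ, ?_, ?_⟩
  · rw [inner_sp, cos_sub, c1, c2, ← I1]
    linear_combination (-sin s * cos φ) * e1 - sin s * sin φ * e2 + B * hin +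
      A * sin_sq_add_cos_sq s + A * sin s ^ 2 * sin_sq_add_cos_sq φ
  · rw [inner_sp, cos_sub, c1, c2, ← I2]
    linear_combination (-sin s' * cos φ') * e1 - sin s' * sin φ' * e2 + A * hin +
      B * sin_sq_add_cos_sq s' + B * sin s' ^ 2 * sin_sq_add_cos_sq φ'

theorem lune_case {Z : Type*} [MetricSpace Z] [IsCATOne Z] {x y : Z} (hxy : dist x y = π)
    {γm γp : ℝ → Z} (hm : Geo γm x y) (hp : Geo γp x y) {θ : ℝ} (hθ0 : 0 ≤ θ) (hθ : θ < π)
    (hP : ∀ s ∈ Icc 0 π, ∀ t ∈ Icc 0 π,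
      cos (dist (γm s) (γp t)) = cos s * cos t + sin s * sin t * cos θ) :
    ∃ C : Set Z, (γm '' Set.Icc 0 π ∪ γp '' Set.Icc 0 π) ⊆ C ∧ PiConvex C ∧
        ∃ f : Z → EuclideanSpace ℝ (Fin 3),
          (∀ p ∈ C, ∀ q ∈ C, dist p q = sph3Dist (f p) (f q)) ∧
          f '' C = LuneModel θ := by
  have pp := pi_pos
  have hhalf : π / 2 ∈ Icc 0 π := ⟨by linarith, by linarith⟩
  have hpq : dist (γm (π / 2)) (γp (π / 2)) = θ := by
    rw [dist_eq hm hp hhalf hhalf (hP _ hhalf _ hhalf)]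
    simp [arccos_cos hθ0 hθ.le]
  obtain ⟨σ, σ0, σ1, σg⟩ := IsCATOne.geodesics (γm (π / 2)) (γp (π / 2)) (by rw [hpq]; exact hθ)
  have hσ : GeodesicBetween σ (γm (π / 2)) (γp (π / 2)) := ⟨σ0, σ1, σg⟩
  rw [hpq] at σ1 σg
  have comp : ∀ z, dist (γm (π / 2)) z = π / 2 → dist (γp (π / 2)) z = π / 2 →
      ∀ φ ∈ Icc 0 θ, dist z (σ φ) ≤ π / 2 := by
    intro z h1 h2 φ hφ
    have := IsCATOne.comparison _ _ z (by rw [hpq, h2, dist_comm z, h1]; linarith) σ hσ φ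
      (by rw [hpq]; exact hφ)
    rw [hpq, h1, h2] at this
    simpa [sphCompDist] using this
  have hmid : ∀ φ ∈ Icc 0 θ, dist x (σ φ) = π / 2 ∧ dist (σ φ) y = π / 2 := by
    intro φ hφ
    have h1 := comp x (by rw [dist_comm, hm.dl hhalf]) (by rw [dist_comm, hp.dl hhalf]) φ hφ
    have h2 := comp y (by rw [hm.dr hhalf]; ring) (by rw [hp.dr hhalf]; ring) φ hφ
    have h3 := dist_triangle x (σ φ) y
    rw [dist_comm] at h2
    constructor <;> linarith
  have hex : ∀ φ : Icc 0 θ, ∃ γ : ℝ → Z, Geo γ x y ∧ γ (π / 2) = σ φ := fun φ =>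
    exists_through hxy (hmid φ φ.2).1 (hmid φ φ.2).2
  choose G hG hGσ using hex
  have hκ : ∀ γ η : ℝ → Z, Geo γ x y → Geo η x y → ∀ s ∈ Icc 0 π, ∀ t ∈ Icc 0 π,
      dist (γ s) (η t) = arccos (cos s * cos t + sin s * sin t *
        cos (dist (γ (π / 2)) (η (π / 2)))) := by
    intro γ η h h' s hs t ht
    obtain ⟨κ, _, _, hk⟩ := const h h'
    apply dist_eq h h' hs ht
    rw [hk s hs t ht, hk _ hhalf _ hhalf]
    simp
  have hsame : ∀ γ η : ℝ → Z, Geo γ x y → Geo η x y → γ (π / 2) = η (π / 2) →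
      ∀ s ∈ Icc 0 π, γ s = η s := by
    intro γ η h h' he s hs
    have := hκ γ η h h' s hs s hs
    rw [he, dist_self, cos_zero, arccos_eq_zero.2] at this
    · exact dist_eq_zero.1 this
    · nlinarith [sin_sq_add_cos_sq s]
  let g : Icc 0 π × Icc 0 θ → Z := fun i => G i.2 i.1
  let h : Icc 0 π × Icc 0 θ → EuclideanSpace ℝ (Fin 3) := fun i => sp i.1 i.2
  have hgh : ∀ i j, dist (g i) (g j) = sph3Dist (h i) (h j) := by
    rintro ⟨s, φ⟩ ⟨t, ψ⟩
    change dist (G φ s) (G ψ t) = arccos ⟪sp s φ, sp t ψ⟫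
    rw [hκ _ _ (hG φ) (hG ψ) s s.2 t t.2, hGσ, hGσ, σg φ φ.2 ψ ψ.2, cos_abs, inner_sp]
  obtain ⟨f, hf⟩ := extend_map g h (fun i => norm_sp _ _) hgh
  refine ⟨range g, ?_, ?_, f, ?_, ?_⟩
  · have h0 : (0 : ℝ) ∈ Icc 0 θ := ⟨le_rfl, hθ0⟩
    have h1 : θ ∈ Icc 0 θ := ⟨hθ0, le_rfl⟩
    rintro z (⟨s, hs, rfl⟩ | ⟨s, hs, rfl⟩)
    · exact ⟨(⟨s, hs⟩, ⟨0, h0⟩), hsame _ _ (hG _) hm (by rw [hGσ]; exact σ0) s hs⟩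
    · exact ⟨(⟨s, hs⟩, ⟨θ, h1⟩), hsame _ _ (hG _) hp (by rw [hGσ]; exact σ1) s hs⟩
  · rintro p ⟨i, rfl⟩ q ⟨j, rfl⟩ hlt γ hγ t ht
    rcases eq_or_lt_of_le (dist_nonneg (x := g i) (y := g j)) with e | l
    · have : t = 0 := le_antisymm (by rw [e]; exact ht.2) ht.1
      rw [this, hγ.1]; exact ⟨i, rfl⟩
    have habs := abs_real_inner_le_norm (h i) (h j)
    rw [show ‖h i‖ = 1 from norm_sp _ _, show ‖h j‖ = 1 from norm_sp _ _, mul_one, abs_le] at habs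
    have hin : ⟪h i, h j⟫ = cos (dist (g i) (g j)) := by
      rw [hgh, sph3Dist, cos_arccos habs.1 habs.2]
    obtain ⟨r, hr, χ, hχ, e1, e2⟩ := model_convex hθ0 hθ i.1.2 i.2.2 j.1.2 j.2.2 hlt l ht hin
    refine ⟨(⟨r, hr⟩, ⟨χ, hχ⟩), (unique_point hlt hγ ht ?_ ?_).symm⟩
    · rw [hgh, sph3Dist]
      change arccos ⟪sp i.1 i.2, sp r χ⟫ = t
      rw [e1, arccos_cos ht.1 (by linarith [ht.2])]
    · rw [hgh j, sph3Dist]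
      change arccos ⟪sp j.1 j.2, sp r χ⟫ = _
      rw [e2, arccos_cos (by linarith [ht.2]) (by linarith [ht.1])]
  · rintro p ⟨i, rfl⟩ q ⟨j, rfl⟩
    rw [hf, hf, hgh]
  · ext v
    constructor
    · rintro ⟨_, ⟨i, rfl⟩, rfl⟩
      rw [hf]
      exact ⟨i.1, i.1.2, i.2, i.2.2, by simp [h, sp], by simp [h, sp], by simp [h, sp]⟩
    · rintro ⟨s, hs, φ, hφ, e0, e1, e2⟩
      refine ⟨g (⟨s, hs⟩, ⟨φ, hφ⟩), ⟨_, rfl⟩, ?_⟩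
      rw [hf]
      ext k
      fin_cases k
      · simp [h, sp, e0]
      · simp [h, sp, e1]
      · simp [h, sp, e2]

theorem circle_case {Z : Type*} [MetricSpace Z] {x y : Z}
    {γm γp : ℝ → Z} (hm : Geo γm x y) (hp : Geo γp x y)
    (hP : ∀ s ∈ Icc 0 π, ∀ t ∈ Icc 0 π,
      cos (dist (γm s) (γp t)) = cos s * cos t + sin s * sin t * (-1)) :
      ∃ f : Z → EuclideanSpace ℝ (Fin 3),
        (∀ p ∈ γm '' Set.Icc 0 π ∪ γp '' Set.Icc 0 π,
          ∀ q ∈ γm '' Set.Icc 0 π ∪ γp '' Set.Icc 0 π,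
            dist p q = sph3Dist (f p) (f q)) ∧
        f '' (γm '' Set.Icc 0 π ∪ γp '' Set.Icc 0 π) =
          {v : EuclideanSpace ℝ (Fin 3) | ‖v‖ = 1 ∧ v 2 = 0} := by
  let g : Icc 0 π ⊕ Icc 0 π → Z := Sum.elim (fun s => γm s) (fun s => γp s)
  let h : Icc 0 π ⊕ Icc 0 π → EuclideanSpace ℝ (Fin 3) :=
    Sum.elim (fun s => sp s 0) (fun s => sp s π)
  have hself : ∀ γ : ℝ → Z, Geo γ x y → ∀ s ∈ Icc 0 π, ∀ t ∈ Icc 0 π,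
      dist (γ s) (γ t) = arccos (cos s * cos t + sin s * sin t * 1) := by
    intro γ hγ s hs t ht
    rw [hγ.2.2 s hs t ht, mul_one, ← cos_sub, ← cos_abs, arccos_cos (abs_nonneg _)]
    rw [abs_le]; constructor <;> linarith [hs.1, hs.2, ht.1, ht.2]
  have hgh : ∀ i j, dist (g i) (g j) = sph3Dist (h i) (h j) := by
    rintro (s | s) (t | t)
    · change dist (γm s) (γm t) = arccos ⟪sp s 0, sp t 0⟫
      rw [hself γm hm s s.2 t t.2, inner_sp]; simp
    · change dist (γm s) (γp t) = arccos ⟪sp s 0, sp t π⟫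
      rw [dist_eq hm hp s.2 t.2 (hP s s.2 t t.2), inner_sp]; simp
    · change dist (γp s) (γm t) = arccos ⟪sp s π, sp t 0⟫
      rw [dist_comm, dist_eq hm hp t.2 s.2 (hP t t.2 s s.2), inner_sp]; simp; ring_nf
    · change dist (γp s) (γp t) = arccos ⟪sp s π, sp t π⟫
      rw [hself γp hp s s.2 t t.2, inner_sp]; simp
  have hn : ∀ i, ‖h i‖ = 1 := by rintro (s | s) <;> exact norm_sp _ _
  obtain ⟨f, hf⟩ := extend_map g h hn hgh
  have hC : γm '' Set.Icc 0 π ∪ γp '' Set.Icc 0 π = range g := by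
    ext z
    constructor
    · rintro (⟨s, hs, rfl⟩ | ⟨s, hs, rfl⟩)
      · exact ⟨Sum.inl ⟨s, hs⟩, rfl⟩
      · exact ⟨Sum.inr ⟨s, hs⟩, rfl⟩
    · rintro ⟨s | s, rfl⟩
      · exact Or.inl ⟨s, s.2, rfl⟩
      · exact Or.inr ⟨s, s.2, rfl⟩
  refine ⟨f, ?_, ?_⟩
  · rw [hC]
    rintro p ⟨i, rfl⟩ q ⟨j, rfl⟩
    rw [hf, hf, hgh]
  · rw [hC]
    ext v
    constructor
    · rintro ⟨_, ⟨i, rfl⟩, rfl⟩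
      rw [hf]
      refine ⟨hn i, ?_⟩
      rcases i with s | s <;> simp [h, sp]
    · rintro ⟨h1, h2⟩
      have hsum : v 0 ^ 2 + v 1 ^ 2 = 1 := by
        have := EuclideanSpace.real_norm_sq_eq v
        rw [h1, Fin.sum_univ_three, h2] at this
        linarith
      rcases le_total 0 (v 1) with hv | hv
      · obtain ⟨s, hs, e1, e2⟩ := polar hv hsum
        refine ⟨g (Sum.inl ⟨s, hs⟩), ⟨_, rfl⟩, ?_⟩
        rw [hf]
        ext k
        fin_cases k
        · simp [h, sp, e1]
        · simp [h, sp, e2]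
        · simp [h, sp, h2]
      · obtain ⟨s, hs, e1, e2⟩ := polar (u := v 0) (r := - v 1) (by linarith) (by linarith)
        refine ⟨g (Sum.inr ⟨s, hs⟩), ⟨_, rfl⟩, ?_⟩
        rw [hf]
        ext k
        fin_cases k
        · simp [h, sp, e1]
        · simp [h, sp, e2]
        · simp [h, sp, h2]

theorem toGeo {Z : Type*} [MetricSpace Z] {γ : ℝ → Z} {x y : Z} (hxy : dist x y = π)
    (h : GeodesicBetween γ x y) : Geo γ x y := by
  unfold GeodesicBetween at h
  rw [hxy] at h
  exact h

end LuneAux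

/-- Lune Lemma.  In a CAT(1) space, let `ξ, ξ̂` be points at distance exactly `π` and
`γ⁻, γ⁺` geodesics from `ξ` to `ξ̂` making angle `θ` at `ξ`.  If `θ < π` then
`γ⁻ ∪ γ⁺` bounds a spherical lune of angle `θ` (a π-convex subset isometric to the
join `S⁰ ∘ [0,θ]`); if `θ ≥ π` then `γ⁻ ∪ γ⁺` is a round circle of length `2π`
(isometric to a great circle of `S²`). -/
theorem lune_lemma {Z : Type*} [MetricSpace Z] [IsCATOne Z]
    (ξ ξhat : Z) (hdist : dist ξ ξhat = π)
    (γm γp : ℝ → Z) (hm : GeodesicBetween γm ξ ξhat) (hp : GeodesicBetween γp ξ ξhat)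
    (θ : ℝ) (hθ : AngleAt γm γp θ) :
    (θ < π →
      ∃ C : Set Z, (γm '' Set.Icc 0 π ∪ γp '' Set.Icc 0 π) ⊆ C ∧ PiConvex C ∧
        ∃ f : Z → EuclideanSpace ℝ (Fin 3),
          (∀ p ∈ C, ∀ q ∈ C, dist p q = sph3Dist (f p) (f q)) ∧
          f '' C = LuneModel θ) ∧
    (π ≤ θ →
      ∃ f : Z → EuclideanSpace ℝ (Fin 3),
        (∀ p ∈ γm '' Set.Icc 0 π ∪ γp '' Set.Icc 0 π,
          ∀ q ∈ γm '' Set.Icc 0 π ∪ γp '' Set.Icc 0 π,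
            dist p q = sph3Dist (f p) (f q)) ∧
        f '' (γm '' Set.Icc 0 π ∪ γp '' Set.Icc 0 π) =
          {v : EuclideanSpace ℝ (Fin 3) | ‖v‖ = 1 ∧ v 2 = 0}) := by
  have gm := LuneAux.toGeo hdist hm
  have gp := LuneAux.toGeo hdist hp
  obtain ⟨κ, k1, k2, hP⟩ := LuneAux.const gm gp
  have hθκ := LuneAux.angle_eq gm gp k1 k2 hP hθ
  have hcos : cos θ = κ := by rw [hθκ, cos_arccos k1 k2]
  have h0 : 0 ≤ θ := by rw [hθκ]; exact arccos_nonneg _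
  have hpi : θ ≤ π := by rw [hθκ]; exact arccos_le_pi _
  refine ⟨fun h => ?_, fun h => ?_⟩
  · exact LuneAux.lune_case hdist gm gp h0 h (by rw [hcos]; exact hP)
  · have : κ = -1 := by rw [← hcos, le_antisymm hpi h, cos_pi]
    rw [this] at hP
    exact LuneAux.circle_case gm gp hP

end
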